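/- Let N ≥ 2 and α ≥ 0. Let (p_k) be a sequence with p_k > 1, p_k → 1, and for each k let u_k be a nontrivial classical solution of the Hénon problem with exponent p_k. Assume that ‖u_k‖_∞^{p_k−1} → μ for some μ > 0 and that u_k/‖u_k‖_∞ → ω uniformly on B̄, where ω is a classical eigenfunction of the weighted eigenvalue problem with eigenvalue μ and ‖ω‖_∞ = 1. Define c := −(∫_B |x|^α (log|ω|) ω² dx)/(∫_B |x|^α ω² dx), where the integrand |x|^α (log|ω|) ω² is extended by 0 on the set where ω vanishes. Then (‖u_k‖_∞^{p_k−1} − μ(1 + c(p_k−1)))/(p_k−1) → 0 as k → ∞, and μ^{−1/(p_k−1)} u_k → e^c ω uniformly on B̄. -/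

import Mathlib

open Real MeasureTheory Metric Filter Topology

noncomputable section

/-- Euclidean space ℝ^N. -/
abbrev E (N : ℕ) := EuclideanSpace ℝ (Fin N)

/-- The Laplacian of `u : ℝ^N → ℝ`. -/
def lap {N : ℕ} (u : E N → ℝ) (x : E N) : ℝ :=
  ∑ i : Fin N, fderiv ℝ (fun y => fderiv ℝ u y (EuclideanSpace.single i 1)) x
    (EuclideanSpace.single i 1)

/-- The sup norm `‖u‖_∞` of `u` over the closed unit ball. -/
def supN {N : ℕ} (u : E N → ℝ) : ℝ := sSup ((fun x => |u x|) '' closedBall 0 1)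

/-- A classical solution of the Hénon problem with parameter `α` and exponent `p`. -/
def IsHenonSol (N : ℕ) (α p : ℝ) (u : E N → ℝ) : Prop :=
  ContDiffOn ℝ 2 u (ball 0 1) ∧ ContinuousOn u (closedBall 0 1) ∧
  (∀ x ∈ ball (0 : E N) 1, -lap u x = ‖x‖ ^ α * |u x| ^ (p - 1) * u x) ∧
  (∀ x : E N, ‖x‖ = 1 → u x = 0)

/-- A classical eigenfunction of the weighted eigenvalue problem with eigenvalue `μ`. -/
def IsEigenfun (N : ℕ) (α μ : ℝ) (ω : E N → ℝ) : Prop :=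
  ContDiffOn ℝ 2 ω (ball 0 1) ∧ ContinuousOn ω (closedBall 0 1) ∧
  (∃ x ∈ closedBall (0 : E N) 1, ω x ≠ 0) ∧
  (∀ x ∈ ball (0 : E N) 1, -lap ω x = μ * ‖x‖ ^ α * ω x) ∧
  (∀ x : E N, ‖x‖ = 1 → ω x = 0)

lemma integrableOn_ball_of_eq_zero_off_compact {N : ℕ} {G : E N → ℝ} {K : Set (E N)}
    (hG : ContinuousOn G (ball 0 1)) (hK : IsCompact K) (hKb : K ⊆ ball 0 1)
    (h0 : ∀ x ∈ ball (0 : E N) 1, x ∉ K → G x = 0) : IntegrableOn G (ball 0 1) :=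
  ((hG.mono hKb).integrableOn_compact hK).of_forall_sdiff_eq_zero measurableSet_ball
    fun x hx => h0 x hx.1 hx.2

lemma fderiv_eq_zero_off_compact {N : ℕ} {G : E N → ℝ} {K : Set (E N)} (hK : IsCompact K)
    (h0 : ∀ x ∈ ball (0 : E N) 1, x ∉ K → G x = 0) {x : E N} (hx : x ∈ ball (0 : E N) 1)
    (hxK : x ∉ K) : fderiv ℝ G x = 0 := by
  have : G =ᶠ[𝓝 x] fun _ => 0 := by
    filter_upwards [isOpen_ball.mem_nhds hx, hK.isClosed.isOpen_compl.mem_nhds hxK] with y hy hyK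
      using h0 y hy hyK
  rw [this.fderiv_eq]
  simp

lemma continuousOn_fderiv_apply {N : ℕ} {G : E N → ℝ} (hG : ContDiffOn ℝ 1 G (ball 0 1))
    (e : E N) : ContinuousOn (fun x => fderiv ℝ G x e) (ball 0 1) :=
  (hG.continuousOn_fderiv_of_isOpen isOpen_ball le_rfl).clm_apply continuousOn_const

lemma integrableOn_fderiv_apply_ball {N : ℕ} {G : E N → ℝ} {K : Set (E N)}
    (hG : ContDiffOn ℝ 1 G (ball 0 1)) (hK : IsCompact K) (hKb : K ⊆ ball 0 1)
    (h0 : ∀ x ∈ ball (0 : E N) 1, x ∉ K → G x = 0) (e : E N) :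
    IntegrableOn (fun x => fderiv ℝ G x e) (ball 0 1) :=
  integrableOn_ball_of_eq_zero_off_compact (continuousOn_fderiv_apply hG e) hK hKb
    fun x hx hxK => by simp [fderiv_eq_zero_off_compact hK h0 hx hxK]

/-- The divergence theorem for a field with compact support in the ball. -/
lemma integral_fderiv_apply_ball_eq_zero {N : ℕ} {G : E N → ℝ} {K : Set (E N)}
    (hG : ContDiffOn ℝ 1 G (ball 0 1)) (hK : IsCompact K) (hKb : K ⊆ ball 0 1)
    (h0 : ∀ x ∈ ball (0 : E N) 1, x ∉ K → G x = 0) (e : E N) :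
    ∫ x in ball 0 1, fderiv ℝ G x e = 0 := by
  set H : E N → ℝ := (ball 0 1).indicator G with hH
  have hoff : ∀ x, x ∉ K → H x = 0 := fun x hx => by
    by_cases hb : x ∈ ball (0 : E N) 1
    · rw [hH, Set.indicator_of_mem hb, h0 x hb hx]
    · rw [hH, Set.indicator_of_notMem hb]
  have hin : ∀ x ∈ ball (0 : E N) 1, H =ᶠ[𝓝 x] G := fun x hx => by
    filter_upwards [isOpen_ball.mem_nhds hx] with y hy using Set.indicator_of_mem hy G
  have hout : ∀ x, x ∉ K → H =ᶠ[𝓝 x] fun _ => 0 := fun x hx => by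
    filter_upwards [hK.isClosed.isOpen_compl.mem_nhds hx] with y hy using hoff y hy
  have hdiff : Differentiable ℝ H := fun x => by
    by_cases hx : x ∈ ball (0 : E N) 1
    · exact ((hG.differentiableOn one_ne_zero).differentiableAt
        (isOpen_ball.mem_nhds hx)).congr_of_eventuallyEq (hin x hx)
    · exact (differentiableAt_const 0).congr_of_eventuallyEq (hout x fun h => hx (hKb h))
  have hfd : (fun x => fderiv ℝ H x e) = (ball 0 1).indicator fun x => fderiv ℝ G x e := by
    ext x
    by_cases hx : x ∈ ball (0 : E N) 1
    · rw [Set.indicator_of_mem hx, (hin x hx).fderiv_eq]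
    · rw [Set.indicator_of_notMem hx, (hout x fun h => hx (hKb h)).fderiv_eq]
      simp
  have hGi : Integrable H :=
    (integrable_indicator_iff measurableSet_ball).2
      (integrableOn_ball_of_eq_zero_off_compact hG.continuousOn hK hKb h0)
  have hGd : Integrable fun x => fderiv ℝ H x e := by
    rw [hfd]
    exact (integrable_indicator_iff measurableSet_ball).2
      (integrableOn_fderiv_apply_ball hG hK hKb h0 e)
  have key := integral_mul_fderiv_eq_neg_fderiv_mul_of_integrable (μ := volume)
    (f := fun _ : E N => (1 : ℝ)) (g := H) (v := e) (by simp) (by simpa using hGd)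
    (by simpa using hGi) (fun x _ => differentiableAt_const _) (fun x _ => hdiff x)
  rw [← integral_indicator measurableSet_ball, ← hfd]
  simpa using key

lemma exists_cutoff : ∃ χ : ℝ → ℝ, ContDiff ℝ 1 χ ∧ Monotone χ ∧ (∀ t, 0 ≤ χ t) ∧ (∀ t, χ t ≤ 1) ∧
    (∀ t ≤ 1, χ t = 0) ∧ (∀ t, 2 ≤ t → χ t = 1) ∧ (∀ t, 0 ≤ deriv χ t) ∧
    ∃ C, 0 ≤ C ∧ ∀ t, 0 ≤ t → t * deriv χ t ≤ C * (χ (2 * t) - χ (t / 2)) := by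
  let χ : ℝ → ℝ := fun t => Real.smoothTransition (t - 1)
  have hχ : ContDiff ℝ 1 χ := Real.smoothTransition.contDiff.comp (contDiff_id.sub contDiff_const)
  have hm : Monotone χ := fun a b hab => Real.smoothTransition.monotone (by linarith)
  have hz : ∀ t ≤ 1, χ t = 0 := fun t ht => Real.smoothTransition.zero_of_nonpos (by linarith)
  have ho : ∀ t, 2 ≤ t → χ t = 1 := fun t ht => Real.smoothTransition.one_of_one_le (by linarith)
  have hdz : ∀ t < 1, deriv χ t = 0 := fun t ht => by
    have : χ =ᶠ[𝓝 t] fun _ => 0 := by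
      filter_upwards [Iio_mem_nhds ht] with s hs using hz s (le_of_lt hs)
    simp [this.deriv_eq]
  have hdo : ∀ t, 2 < t → deriv χ t = 0 := fun t ht => by
    have : χ =ᶠ[𝓝 t] fun _ => 1 := by
      filter_upwards [Ioi_mem_nhds ht] with s hs using ho s (le_of_lt hs)
    simp [this.deriv_eq]
  obtain ⟨C, hC⟩ := (isCompact_Icc (a := (1 : ℝ)) (b := 2)).exists_bound_of_continuousOn
    (hχ.continuous_deriv le_rfl).continuousOn
  refine ⟨χ, hχ, hm, fun t => Real.smoothTransition.nonneg _,
    fun t => Real.smoothTransition.le_one _, hz, ho, fun t => hm.deriv_nonneg,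
    2 * |C|, by positivity, fun t ht => ?_⟩
  have hmono : 0 ≤ χ (2 * t) - χ (t / 2) := sub_nonneg.2 (hm (by linarith))
  rcases lt_or_ge t 1 with h1 | h1
  · rw [hdz t h1, mul_zero]; positivity
  rcases lt_or_ge 2 t with h2 | h2
  · rw [hdo t h2, mul_zero]; positivity
  rw [ho (2 * t) (by linarith), hz (t / 2) (by linarith), sub_zero, mul_one]
  have hd : deriv χ t ≤ |C| := (le_abs_self _).trans ((hC t ⟨h1, h2⟩).trans (le_abs_self C))
  exact mul_le_mul h2 hd hm.deriv_nonneg (by norm_num)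

lemma isCompact_superlevel {N : ℕ} {s : E N → ℝ} (hs : ContinuousOn s (closedBall 0 1)) (l : ℝ) :
    IsCompact {x ∈ closedBall (0 : E N) 1 | 1 ≤ l * s x} := by
  have : IsClosed (closedBall (0 : E N) 1 ∩ (fun x => l * s x) ⁻¹' Set.Ici 1) :=
    (continuousOn_const.mul hs).preimage_isClosed_of_isClosed isClosed_closedBall isClosed_Ici
  exact (isCompact_closedBall 0 1).of_isClosed_subset this Set.inter_subset_left

lemma superlevel_subset_ball {N : ℕ} {s : E N → ℝ} (h0 : ∀ x : E N, ‖x‖ = 1 → s x = 0) (l : ℝ) :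
    {x ∈ closedBall (0 : E N) 1 | 1 ≤ l * s x} ⊆ ball 0 1 := by
  rintro x ⟨hx, hl⟩
  rw [mem_closedBall_zero_iff] at hx
  rw [mem_ball_zero_iff]
  refine lt_of_le_of_ne hx fun h => ?_
  rw [h0 x h, mul_zero] at hl
  linarith

lemma integral_cutoff_mul_fderiv {N : ℕ} {χ : ℝ → ℝ} (hχ : ContDiff ℝ 1 χ)
    (hz : ∀ t ≤ 1, χ t = 0) {v w h : E N → ℝ}
    (hv : ContDiffOn ℝ 1 v (ball 0 1)) (hvc : ContinuousOn v (closedBall 0 1))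
    (hv0 : ∀ x : E N, ‖x‖ = 1 → v x = 0)
    (hw : ContDiffOn ℝ 1 w (ball 0 1)) (hwc : ContinuousOn w (closedBall 0 1))
    (hw0 : ∀ x : E N, ‖x‖ = 1 → w x = 0)
    (hh : ContDiffOn ℝ 1 h (ball 0 1)) (l : ℝ) (e : E N) :
    IntegrableOn (fun x => deriv χ (l * (v x ^ 2 + w x ^ 2)) *
        (l * (2 * (v x * fderiv ℝ v x e + w x * fderiv ℝ w x e))) * h x +
        χ (l * (v x ^ 2 + w x ^ 2)) * fderiv ℝ h x e) (ball 0 1) ∧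
    ∫ x in ball 0 1, (deriv χ (l * (v x ^ 2 + w x ^ 2)) *
        (l * (2 * (v x * fderiv ℝ v x e + w x * fderiv ℝ w x e))) * h x +
        χ (l * (v x ^ 2 + w x ^ 2)) * fderiv ℝ h x e) = 0 := by
  set G : E N → ℝ := fun x => χ (l * (v x ^ 2 + w x ^ 2)) * h x with hGdef
  have hsc : ContinuousOn (fun x => v x ^ 2 + w x ^ 2) (closedBall 0 1) :=
    (hvc.pow 2).add (hwc.pow 2)
  have hs0 : ∀ x : E N, ‖x‖ = 1 → v x ^ 2 + w x ^ 2 = 0 := fun x hx => by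
    rw [hv0 x hx, hw0 x hx]; norm_num
  have hG : ContDiffOn ℝ 1 G (ball 0 1) :=
    (hχ.comp_contDiffOn (contDiffOn_const.mul ((hv.pow 2).add (hw.pow 2)))).mul hh
  have hoff : ∀ x ∈ ball (0 : E N) 1,
      x ∉ {x ∈ closedBall (0 : E N) 1 | 1 ≤ l * (v x ^ 2 + w x ^ 2)} → G x = 0 := fun x hx hn => by
    have : l * (v x ^ 2 + w x ^ 2) ≤ 1 := by
      by_contra! hc
      exact hn ⟨ball_subset_closedBall hx, hc.le⟩
    simp only [hGdef, hz _ this, zero_mul]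
  have hK := isCompact_superlevel hsc l
  have hKb := superlevel_subset_ball hs0 l
  have hfd : Set.EqOn (fun x => fderiv ℝ G x e) (fun x => deriv χ (l * (v x ^ 2 + w x ^ 2)) *
        (l * (2 * (v x * fderiv ℝ v x e + w x * fderiv ℝ w x e))) * h x +
        χ (l * (v x ^ 2 + w x ^ 2)) * fderiv ℝ h x e) (ball 0 1) := fun x hx => by
    have hd : ∀ {f : E N → ℝ}, ContDiffOn ℝ 1 f (ball 0 1) → HasFDerivAt f (fderiv ℝ f x) x :=
      fun hf => ((hf.differentiableOn one_ne_zero).differentiableAt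
        (isOpen_ball.mem_nhds hx)).hasFDerivAt
    have hs := (((hd hv).mul (hd hv)).add ((hd hw).mul (hd hw))).const_mul l
    have hχd : HasDerivAt χ (deriv χ (l * (v x * v x + w x * w x))) (l * (v x * v x + w x * w x)) :=
      (hχ.differentiable one_ne_zero _).hasDerivAt
    have hall := (hχd.comp_hasFDerivAt x hs).mul (hd hh)
    have hGeq : G = (χ ∘ fun x => l * (v x * v x + w x * w x)) * h := by
      ext y; simp [hGdef, sq]
    simp only
    rw [hGeq]
    refine (DFunLike.congr_fun (HasFDerivAt.fderiv hall) e).trans ?_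
    simp [sq]
    ring
  constructor
  · exact (integrableOn_fderiv_apply_ball hG hK hKb hoff e).congr_fun hfd measurableSet_ball
  · rw [← setIntegral_congr_fun measurableSet_ball hfd]
    exact integral_fderiv_apply_ball_eq_zero hG hK hKb hoff e

lemma integrableOn_ball_of_continuousOn {N : ℕ} {f : E N → ℝ}
    (hf : ContinuousOn f (closedBall 0 1)) : IntegrableOn f (ball 0 1) :=
  (hf.integrableOn_compact (isCompact_closedBall 0 1)).mono_set ball_subset_closedBall

/-- Green's second identity on the ball for functions continuous up to the boundary, vanishing
there, whose Laplacian extends continuously to the closed ball. -/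
lemma green_ball {N : ℕ} {v w f g : E N → ℝ}
    (hv : ContDiffOn ℝ 2 v (ball 0 1)) (hvc : ContinuousOn v (closedBall 0 1))
    (hv0 : ∀ x : E N, ‖x‖ = 1 → v x = 0)
    (hw : ContDiffOn ℝ 2 w (ball 0 1)) (hwc : ContinuousOn w (closedBall 0 1))
    (hw0 : ∀ x : E N, ‖x‖ = 1 → w x = 0)
    (hf : ContinuousOn f (closedBall 0 1)) (hg : ContinuousOn g (closedBall 0 1))
    (hvf : ∀ x ∈ ball (0 : E N) 1, -lap v x = f x)
    (hwg : ∀ x ∈ ball (0 : E N) 1, -lap w x = g x) :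
    ∫ x in ball 0 1, (w x * f x - v x * g x) = 0 := by
  obtain ⟨χ, hχ, hχm, hχ0, hχ1, hz, ho, hd0, C, hC, hCb⟩ := exists_cutoff
  have hv1 : ContDiffOn ℝ 1 v (ball 0 1) := hv.of_le one_le_two
  have hw1 : ContDiffOn ℝ 1 w (ball 0 1) := hw.of_le one_le_two
  set e : Fin N → E N := fun i => EuclideanSpace.single i 1 with he
  set s : E N → ℝ := fun x => v x ^ 2 + w x ^ 2 with hs
  set a : Fin N → E N → ℝ := fun i x => fderiv ℝ v x (e i) with ha
  set b : Fin N → E N → ℝ := fun i x => fderiv ℝ w x (e i) with hb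
  set Q : E N → ℝ := fun x => ∑ i, (a i x ^ 2 + b i x ^ 2) with hQ
  have ha1 : ∀ i, ContDiffOn ℝ 1 (a i) (ball 0 1) := fun i =>
    (hv.fderiv_of_isOpen isOpen_ball (m := 1) (by norm_num)).clm_apply contDiffOn_const
  have hb1 : ∀ i, ContDiffOn ℝ 1 (b i) (ball 0 1) := fun i =>
    (hw.fderiv_of_isOpen isOpen_ball (m := 1) (by norm_num)).clm_apply contDiffOn_const
  have hs_nn : ∀ x, 0 ≤ s x := fun x => by positivity
  have hQ_nn : ∀ x, 0 ≤ Q x := fun x => Finset.sum_nonneg fun i _ => by positivity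
  have hsc : ContinuousOn s (closedBall 0 1) := (hvc.pow 2).add (hwc.pow 2)
  have hs0 : ∀ x : E N, ‖x‖ = 1 → s x = 0 := fun x hx => by
    simp only [hs]
    rw [hv0 x hx, hw0 x hx]; norm_num
  have hQc : ContinuousOn Q (ball 0 1) := continuousOn_finsetSum _ fun i _ =>
    ((ha1 i).continuousOn.pow 2).add ((hb1 i).continuousOn.pow 2)
  have hχc : ∀ l : ℝ, ContinuousOn (fun x => χ (l * s x)) (closedBall 0 1) := fun l =>
    hχ.continuous.comp_continuousOn (continuousOn_const.mul hsc)
  have hχQ : ∀ l : ℝ, IntegrableOn (fun x => χ (l * s x) * Q x) (ball 0 1) := fun l => by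
    refine integrableOn_ball_of_eq_zero_off_compact
      (((hχc l).mono ball_subset_closedBall).mul hQc) (isCompact_superlevel hsc l)
      (superlevel_subset_ball hs0 l) fun x hx hn => ?_
    have : l * s x ≤ 1 := by
      by_contra! hc
      exact hn ⟨ball_subset_closedBall hx, hc.le⟩
    rw [hz _ this, zero_mul]
  set A : ℝ → ℝ := fun l => ∫ x in ball 0 1, χ (l * s x) * Q x with hA
  set C0 : ℝ := ∫ x in ball 0 1, |v x * f x + w x * g x| with hC0
  have hdv : ∀ x ∈ ball (0 : E N) 1, ∀ {φ : E N → ℝ}, ContDiffOn ℝ 1 φ (ball 0 1) →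
      HasFDerivAt φ (fderiv ℝ φ x) x := fun x hx φ hφ =>
    ((hφ.differentiableOn one_ne_zero).differentiableAt (isOpen_ball.mem_nhds hx)).hasFDerivAt
  have hlapv : ∀ x ∈ ball (0 : E N) 1, ∑ i, fderiv ℝ (a i) x (e i) = -f x := fun x hx => by
    rw [← hvf x hx, neg_neg]; rfl
  have hlapw : ∀ x ∈ ball (0 : E N) 1, ∑ i, fderiv ℝ (b i) x (e i) = -g x := fun x hx => by
    rw [← hwg x hx, neg_neg]; rfl
  -- the energy bound
  have hAle : ∀ l : ℝ, 0 ≤ l → A l ≤ C0 := fun l hl => by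
    have hR : ∀ i, ContDiffOn ℝ 1 (fun x => v x * a i x + w x * b i x) (ball 0 1) := fun i =>
      (hv1.mul (ha1 i)).add (hw1.mul (hb1 i))
    have key := fun i => integral_cutoff_mul_fderiv hχ hz hv1 hvc hv0 hw1 hwc hw0 (hR i) l (e i)
    have hint := integrable_finsetSum (μ := volume.restrict (ball (0 : E N) 1)) Finset.univ
      fun i _ => (key i).1
    have hsum := integral_finsetSum (μ := volume.restrict (ball (0 : E N) 1)) Finset.univ
      fun i _ => (key i).1
    rw [Finset.sum_eq_zero fun i _ => (key i).2] at hsum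
    have habs : IntegrableOn (fun x => |v x * f x + w x * g x|) (ball 0 1) :=
      integrableOn_ball_of_continuousOn ((hvc.mul hf).add (hwc.mul hg)).abs
    have hle : ∫ x in ball 0 1, (χ (l * s x) * Q x - |v x * f x + w x * g x|) ≤ 0 := by
      rw [← hsum]
      refine setIntegral_mono_on ((hχQ l).sub habs) hint measurableSet_ball fun x hx => ?_
      have hfd : ∀ i, fderiv ℝ (fun x => v x * a i x + w x * b i x) x (e i) =
          a i x ^ 2 + b i x ^ 2 + (v x * fderiv ℝ (a i) x (e i) + w x * fderiv ℝ (b i) x (e i)) :=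
        fun i => by
          have := (((hdv x hx hv1).mul (hdv x hx (ha1 i))).add
            ((hdv x hx hw1).mul (hdv x hx (hb1 i)))).fderiv
          have h2 := DFunLike.congr_fun this (e i)
          refine h2.trans ?_
          simp [ha, hb]
          ring
      simp only [hfd, mul_add (χ _), Finset.sum_add_distrib, ← Finset.mul_sum]
      rw [hlapv x hx, hlapw x hx]
      have h1 : 0 ≤ ∑ i, deriv χ (l * (v x ^ 2 + w x ^ 2)) *
          (l * (2 * (v x * fderiv ℝ v x (e i) + w x * fderiv ℝ w x (e i)))) *
          (v x * a i x + w x * b i x) := Finset.sum_nonneg fun i _ => by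
        have : deriv χ (l * (v x ^ 2 + w x ^ 2)) *
          (l * (2 * (v x * fderiv ℝ v x (e i) + w x * fderiv ℝ w x (e i)))) *
          (v x * a i x + w x * b i x) = deriv χ (l * (v x ^ 2 + w x ^ 2)) *
          (l * (2 * (v x * a i x + w x * b i x) ^ 2)) := by simp only [ha, hb]; ring
        rw [this]
        exact mul_nonneg (hd0 _) (by positivity)
      have h2 : χ (l * s x) * (v x * f x + w x * g x) ≤ |v x * f x + w x * g x| := by
        calc _ ≤ |χ (l * s x) * (v x * f x + w x * g x)| := le_abs_self _
          _ = χ (l * s x) * |v x * f x + w x * g x| := by rw [abs_mul, abs_of_nonneg (hχ0 _)]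
          _ ≤ _ := mul_le_of_le_one_left (abs_nonneg _) (hχ1 _)
      simp only [hQ, Finset.sum_add_distrib]
      simp only [hs] at h2 ⊢
      linarith
    rw [integral_sub (hχQ l) habs] at hle
    linarith
  -- the commutator estimate
  have hcomm : ∀ l : ℝ, 0 ≤ l → |∫ x in ball 0 1, χ (l * s x) * (w x * f x - v x * g x)| ≤
      2 * C * (A (2 * l) - A (l / 2)) := fun l hl => by
    have hR : ∀ i, ContDiffOn ℝ 1 (fun x => w x * a i x - v x * b i x) (ball 0 1) := fun i =>
      (hw1.mul (ha1 i)).sub (hv1.mul (hb1 i))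
    have key := fun i => integral_cutoff_mul_fderiv hχ hz hv1 hvc hv0 hw1 hwc hw0 (hR i) l (e i)
    have hint := integrable_finsetSum (μ := volume.restrict (ball (0 : E N) 1)) Finset.univ
      fun i _ => (key i).1
    have hsum := integral_finsetSum (μ := volume.restrict (ball (0 : E N) 1)) Finset.univ
      fun i _ => (key i).1
    rw [Finset.sum_eq_zero fun i _ => (key i).2] at hsum
    have hlhs : IntegrableOn (fun x => χ (l * s x) * (w x * f x - v x * g x)) (ball 0 1) :=
      integrableOn_ball_of_continuousOn ((hχc l).mul ((hwc.mul hf).sub (hvc.mul hg)))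
    have hadd := integral_add hlhs hint
    rw [hsum, add_zero] at hadd
    rw [← hadd, hA]
    simp only
    rw [← integral_sub (hχQ _) (hχQ _), ← integral_const_mul, ← Real.norm_eq_abs]
    refine norm_integral_le_of_norm_le (((hχQ _).sub (hχQ _)).const_mul _)
      ((ae_restrict_iff' measurableSet_ball).2 (ae_of_all _ fun x hx => ?_))
    have hfd : ∀ i, fderiv ℝ (fun x => w x * a i x - v x * b i x) x (e i) =
        w x * fderiv ℝ (a i) x (e i) - v x * fderiv ℝ (b i) x (e i) :=
      fun i => by
        have := (((hdv x hx hw1).mul (hdv x hx (ha1 i))).sub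
          ((hdv x hx hv1).mul (hdv x hx (hb1 i)))).fderiv
        have h2 := DFunLike.congr_fun this (e i)
        refine h2.trans ?_
        simp [ha, hb]
        ring
    have hterm : ∀ i, deriv χ (l * (v x ^ 2 + w x ^ 2)) *
          (l * (2 * (v x * fderiv ℝ v x (e i) + w x * fderiv ℝ w x (e i)))) *
          (w x * a i x - v x * b i x) = deriv χ (l * s x) * (2 * l) *
          ((v x * a i x + w x * b i x) * (w x * a i x - v x * b i x)) := fun i => by
      simp only [ha, hb, hs]; ring
    simp only [hfd, hterm, Finset.sum_add_distrib, mul_sub (χ _), Finset.sum_sub_distrib,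
      ← Finset.mul_sum]
    rw [hlapv x hx, hlapw x hx]
    set T := ∑ i, (v x * a i x + w x * b i x) * (w x * a i x - v x * b i x) with hT
    have hTb : |T| ≤ s x * Q x := by
      rw [hT, hQ, Finset.mul_sum]
      refine (Finset.abs_sum_le_sum_abs _ _).trans (Finset.sum_le_sum fun i _ => ?_)
      rw [abs_le]
      simp only [hs]
      constructor <;> nlinarith [sq_nonneg (v x * a i x + w x * b i x + (w x * a i x - v x * b i x)),
        sq_nonneg (v x * a i x + w x * b i x - (w x * a i x - v x * b i x)),
        sq_nonneg (v x * a i x + w x * b i x), sq_nonneg (w x * a i x - v x * b i x)]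
    have heq : χ (l * s x) * (w x * f x) - χ (l * s x) * (v x * g x) +
        (deriv χ (l * s x) * (2 * l) * T +
          (χ (l * (v x ^ 2 + w x ^ 2)) * (w x * -f x) -
            χ (l * (v x ^ 2 + w x ^ 2)) * (v x * -g x))) = deriv χ (l * s x) * (2 * l) * T := by
      simp only [hs]; ring
    have hD := hCb (l * s x) (mul_nonneg hl (hs_nn x))
    calc _ = |deriv χ (l * s x) * (2 * l) * T| := congrArg abs heq
      _ = deriv χ (l * s x) * (2 * l) * |T| := by
        rw [abs_mul, abs_of_nonneg (mul_nonneg (hd0 _) (by positivity))]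
      _ ≤ deriv χ (l * s x) * (2 * l) * (s x * Q x) :=
        mul_le_mul_of_nonneg_left hTb (mul_nonneg (hd0 _) (by positivity))
      _ = 2 * (l * s x * deriv χ (l * s x)) * Q x := by ring
      _ ≤ 2 * (C * (χ (2 * (l * s x)) - χ (l * s x / 2))) * Q x := by
        have := hQ_nn x
        gcongr
      _ = _ := by
        rw [show 2 * (l * s x) = 2 * l * s x by ring, show l * s x / 2 = l / 2 * s x by ring]
        ring
  -- pass to the limit
  have hmono : Monotone fun n : ℕ => A (4 ^ n) := fun m n hmn =>
    setIntegral_mono_on (hχQ _) (hχQ _) measurableSet_ball fun x _ =>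
      mul_le_mul_of_nonneg_right (hχm (mul_le_mul_of_nonneg_right
        (pow_le_pow_right₀ (by norm_num) hmn) (hs_nn x))) (hQ_nn x)
  have hbdd : BddAbove (Set.range fun n : ℕ => A (4 ^ n)) :=
    ⟨C0, by rintro _ ⟨n, rfl⟩; exact hAle _ (by positivity)⟩
  have hlim := tendsto_atTop_ciSup hmono hbdd
  have hdiff := (((tendsto_add_atTop_iff_nat 1).2 hlim).sub hlim).const_mul (2 * C)
  rw [sub_self, mul_zero] at hdiff
  have hzero : Tendsto (fun n : ℕ =>
      ∫ x in ball 0 1, χ (2 * 4 ^ n * s x) * (w x * f x - v x * g x)) atTop (𝓝 0) := by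
    refine squeeze_zero_norm (fun n => ?_) hdiff
    have := hcomm (2 * 4 ^ n) (by positivity)
    rw [show (2 : ℝ) * (2 * 4 ^ n) = 4 ^ (n + 1) by ring,
      show (2 : ℝ) * 4 ^ n / 2 = 4 ^ n by ring] at this
    exact this
  have hwv : ContinuousOn (fun x => w x * f x - v x * g x) (closedBall 0 1) :=
    (hwc.mul hf).sub (hvc.mul hg)
  refine tendsto_nhds_unique (tendsto_integral_of_dominated_convergence
    (fun x => |w x * f x - v x * g x|) (fun n => ?_)
    (integrableOn_ball_of_continuousOn hwv.abs) (fun n => ae_of_all _ fun x => ?_)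
    (ae_of_all _ fun x => ?_)) hzero
  · exact (integrableOn_ball_of_continuousOn ((hχc _).mul hwv)).aestronglyMeasurable
  · rw [Real.norm_eq_abs, abs_mul, abs_of_nonneg (hχ0 _)]
    exact mul_le_of_le_one_left (abs_nonneg _) (hχ1 _)
  · rcases (hs_nn x).eq_or_lt with h | h
    · have hv' : v x = 0 := by
        simp only [hs] at h; nlinarith [sq_nonneg (v x), sq_nonneg (w x)]
      have hw' : w x = 0 := by
        simp only [hs] at h; nlinarith [sq_nonneg (v x), sq_nonneg (w x)]
      simp [hv', hw']
    · refine tendsto_const_nhds.congr' ?_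
      have ht : Tendsto (fun n : ℕ => 2 * (4 : ℝ) ^ n * s x) atTop atTop :=
        ((tendsto_pow_atTop_atTop_of_one_lt (by norm_num)).const_mul_atTop two_pos).atTop_mul_const h
      filter_upwards [ht.eventually_ge_atTop 2] with n hn
      rw [ho _ hn, one_mul]

lemma log_le_rpow_sub_one_div {t q : ℝ} (ht : 0 < t) (hq : 0 < q) :
    Real.log t ≤ (t ^ q - 1) / q := by
  rw [le_div_iff₀ hq, Real.rpow_def_of_pos ht]
  linarith [Real.add_one_le_exp (Real.log t * q)]

lemma rpow_sub_one_div_le {t q : ℝ} (ht : 0 < t) (hq : 0 < q) :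
    (t ^ q - 1) / q ≤ t ^ q * Real.log t := by
  rw [div_le_iff₀ hq, Real.rpow_def_of_pos ht]
  have h1 := Real.add_one_le_exp (-(Real.log t * q))
  have h2 : Real.exp (Real.log t * q) * Real.exp (-(Real.log t * q)) = 1 := by
    rw [← Real.exp_add, add_neg_cancel, Real.exp_zero]
  nlinarith [mul_le_mul_of_nonneg_left h1 (Real.exp_pos (Real.log t * q)).le]

lemma tendsto_rpow_sub_one_div {t q : ℕ → ℝ} {a : ℝ} (ha : 0 < a) (ht : Tendsto t atTop (𝓝 a))
    (hq : ∀ k, 0 < q k) (hq0 : Tendsto q atTop (𝓝 0)) :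
    Tendsto (fun k => (t k ^ q k - 1) / q k) atTop (𝓝 (Real.log a)) := by
  have hlog := ht.log ha.ne'
  have hup : Tendsto (fun k => t k ^ q k * Real.log (t k)) atTop (𝓝 (Real.log a)) := by
    simpa using (ht.rpow hq0 (Or.inl ha.ne')).mul hlog
  have hpos := ht.eventually (lt_mem_nhds ha)
  exact tendsto_of_tendsto_of_tendsto_of_le_of_le' hlog hup
    (hpos.mono fun k hk => log_le_rpow_sub_one_div hk (hq k))
    (hpos.mono fun k hk => rpow_sub_one_div_le hk (hq k))

lemma abs_rpow_sub_one_div_mul_le_one {t q : ℝ} (ht : |t| ≤ 1) (hq : 0 < q) :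
    |(|t| ^ q - 1) / q * t| ≤ 1 := by
  rcases (abs_nonneg t).eq_or_lt with h | h
  · rw [abs_eq_zero.1 h.symm]; simp
  have h1 := log_le_rpow_sub_one_div h hq
  have h2 : (|t| ^ q - 1) / q ≤ 0 :=
    div_nonpos_of_nonpos_of_nonneg (by linarith [Real.rpow_le_one h.le ht hq.le]) hq.le
  rw [abs_mul, abs_of_nonpos h2]
  have h3 := Real.one_sub_inv_le_log_of_pos h
  have h4 : |t|⁻¹ * |t| = 1 := inv_mul_cancel₀ h.ne'
  nlinarith

lemma bddAbove_abs_image {N : ℕ} {u : E N → ℝ} (hu : ContinuousOn u (closedBall 0 1)) :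
    BddAbove ((fun x => |u x|) '' closedBall 0 1) :=
  ((isCompact_closedBall 0 1).image_of_continuousOn hu.abs).bddAbove

lemma abs_le_supN {N : ℕ} {u : E N → ℝ} (hu : ContinuousOn u (closedBall 0 1)) {x : E N}
    (hx : x ∈ closedBall (0 : E N) 1) : |u x| ≤ supN u :=
  le_csSup (bddAbove_abs_image hu) ⟨x, hx, rfl⟩

lemma supN_pos {N : ℕ} {u : E N → ℝ} (hu : ContinuousOn u (closedBall 0 1))
    (hne : ∃ x ∈ closedBall (0 : E N) 1, u x ≠ 0) : 0 < supN u := by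
  obtain ⟨x, hx, h⟩ := hne
  exact (abs_pos.2 h).trans_le (abs_le_supN hu hx)

lemma continuous_norm_rpow {N : ℕ} {α : ℝ} (hα : 0 ≤ α) : Continuous fun x : E N => ‖x‖ ^ α :=
  continuous_norm.rpow_const fun _ => Or.inr hα

lemma norm_rpow_le_one {N : ℕ} {α : ℝ} (hα : 0 ≤ α) {x : E N} (hx : x ∈ ball (0 : E N) 1) :
    ‖x‖ ^ α ≤ 1 :=
  Real.rpow_le_one (norm_nonneg x) (mem_ball_zero_iff.1 hx).le hα

lemma integral_weight_mul_sq_pos {N : ℕ} (hN : 2 ≤ N) {α : ℝ} (hα : 0 ≤ α) {ω : E N → ℝ}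
    (hω : ContinuousOn ω (closedBall 0 1)) (hne : ∃ x ∈ closedBall (0 : E N) 1, ω x ≠ 0)
    (h0 : ∀ x : E N, ‖x‖ = 1 → ω x = 0) : 0 < ∫ x in ball (0 : E N) 1, ‖x‖ ^ α * ω x ^ 2 := by
  have hnn : ∀ x, 0 ≤ ‖x‖ ^ α * ω x ^ 2 := fun x => by positivity
  refine (integral_nonneg hnn).lt_of_ne fun h => ?_
  have hint : IntegrableOn (fun x => ‖x‖ ^ α * ω x ^ 2) (ball 0 1) :=
    integrableOn_ball_of_continuousOn ((continuous_norm_rpow hα).continuousOn.mul (hω.pow 2))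
  have hae := (integral_eq_zero_iff_of_nonneg hnn hint).1 h.symm
  have : NeZero N := ⟨by omega⟩
  have hne0 : ∀ᵐ x ∂(volume.restrict (ball (0 : E N) 1)), x ≠ 0 :=
    ae_restrict_of_ae (compl_mem_ae_iff.2 (measure_singleton (0 : E N)))
  have hω0 : ω =ᵐ[volume.restrict (ball (0 : E N) 1)] fun _ => 0 := by
    filter_upwards [hae, hne0] with x hx hx0
    have hpos : 0 < ‖x‖ ^ α := Real.rpow_pos_of_pos (norm_pos_iff.2 hx0) _
    exact pow_eq_zero_iff two_ne_zero |>.1 ((mul_eq_zero.1 hx).resolve_left hpos.ne')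
  have heq := Measure.eqOn_open_of_ae_eq hω0 isOpen_ball (hω.mono ball_subset_closedBall)
    continuousOn_const
  obtain ⟨x, hx, hxne⟩ := hne
  rcases (mem_closedBall_zero_iff.1 hx).eq_or_lt with h1 | h1
  · exact hxne (h0 x h1)
  · exact hxne (heq (mem_ball_zero_iff.2 h1))

/-- The orthogonality relation between a normalized solution and an eigenfunction. -/
lemma sub_mul_integral_add_eq_zero {N : ℕ} {α p μ : ℝ} (hα : 0 ≤ α) (hp : 1 < p) {u ω : E N → ℝ}
    (hu : IsHenonSol N α p u) (hω : IsEigenfun N α μ ω) (hm : 0 < supN u) :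
    (supN u ^ (p - 1) - μ) *
        (∫ x in ball 0 1, ‖x‖ ^ α * (|u x / supN u| ^ (p - 1) * (u x / supN u) * ω x)) +
      μ * (p - 1) * (∫ x in ball 0 1,
        ‖x‖ ^ α * ((|u x / supN u| ^ (p - 1) - 1) / (p - 1) * (u x / supN u) * ω x)) = 0 := by
  obtain ⟨hu2, huc, hue, hu0⟩ := hu
  obtain ⟨hω2, hωc, -, hωe, hω0⟩ := hω
  have hq : 0 < p - 1 := sub_pos.2 hp
  have hW : ContinuousOn (fun x : E N => ‖x‖ ^ α) (closedBall 0 1) :=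
    (continuous_norm_rpow hα).continuousOn
  have hg := green_ball hu2 huc hu0 hω2 hωc hω0
    ((hW.mul (huc.abs.rpow_const fun _ _ => Or.inr hq.le)).mul huc)
    ((continuousOn_const.mul hW).mul hωc) hue hωe
  have hv : ContinuousOn (fun x => u x / supN u) (closedBall 0 1) := huc.div_const _
  have hvq : ContinuousOn (fun x => |u x / supN u| ^ (p - 1)) (closedBall 0 1) :=
    hv.abs.rpow_const fun _ _ => Or.inr hq.le
  have hI : IntegrableOn (fun x => ‖x‖ ^ α * (|u x / supN u| ^ (p - 1) * (u x / supN u) * ω x))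
      (ball 0 1) := integrableOn_ball_of_continuousOn (hW.mul ((hvq.mul hv).mul hωc))
  have hJ : IntegrableOn (fun x => ‖x‖ ^ α *
      ((|u x / supN u| ^ (p - 1) - 1) / (p - 1) * (u x / supN u) * ω x)) (ball 0 1) :=
    integrableOn_ball_of_continuousOn
      (hW.mul ((((hvq.sub continuousOn_const).div_const _).mul hv).mul hωc))
  rw [← integral_const_mul, ← integral_const_mul, ← integral_add (hI.const_mul _) (hJ.const_mul _)]
  refine (mul_eq_zero.1 ?_).resolve_left hm.ne'
  rw [← integral_const_mul, ← hg]
  refine integral_congr_ae (ae_of_all _ fun x => ?_)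
  have habs : |u x| ^ (p - 1) = supN u ^ (p - 1) * |u x / supN u| ^ (p - 1) := by
    rw [← Real.mul_rpow hm.le (abs_nonneg _), abs_div, abs_of_pos hm, mul_div_cancel₀ _ hm.ne']
  simp only [Pi.mul_apply]
  rw [habs]
  generalize |u x / supN u| ^ (p - 1) = X
  field_simp
  ring

/-- refined asymptotics.  Note that in Lean `Real.log 0 = 0`, so the integrand
`‖x‖^α * log |ω x| * (ω x)²` is automatically extended by `0` on the set where `ω` vanishes. -/
theorem stmt_1 (N : ℕ) (hN : 2 ≤ N) (α : ℝ) (hα : 0 ≤ α)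
    (p : ℕ → ℝ) (hp : ∀ k, 1 < p k) (hp1 : Tendsto p atTop (𝓝 1))
    (u : ℕ → E N → ℝ) (hsol : ∀ k, IsHenonSol N α (p k) (u k))
    (hnt : ∀ k, ∃ x ∈ closedBall (0 : E N) 1, u k x ≠ 0)
    (μ : ℝ) (hμ : 0 < μ) (ω : E N → ℝ) (hω : IsEigenfun N α μ ω) (hω1 : supN ω = 1)
    (hconv1 : Tendsto (fun k => supN (u k) ^ (p k - 1)) atTop (𝓝 μ))
    (hconv2 : TendstoUniformlyOn (fun k x => u k x / supN (u k)) ω atTop (closedBall 0 1)) :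
    Tendsto
      (fun k => (supN (u k) ^ (p k - 1) - μ * (1 +
        (-(∫ x in ball (0 : E N) 1, ‖x‖ ^ α * Real.log |ω x| * (ω x) ^ 2) /
          (∫ x in ball (0 : E N) 1, ‖x‖ ^ α * (ω x) ^ 2)) * (p k - 1))) / (p k - 1))
      atTop (𝓝 0) ∧
    TendstoUniformlyOn (fun k x => μ ^ (-(1 / (p k - 1))) * u k x)
      (fun x => Real.exp
        (-(∫ x in ball (0 : E N) 1, ‖x‖ ^ α * Real.log |ω x| * (ω x) ^ 2) /
          (∫ x in ball (0 : E N) 1, ‖x‖ ^ α * (ω x) ^ 2)) * ω x)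
      atTop (closedBall 0 1) := by
  set S := ball (0 : E N) 1 with hS
  set num := ∫ x in S, ‖x‖ ^ α * Real.log |ω x| * (ω x) ^ 2 with hnum
  set den := ∫ x in S, ‖x‖ ^ α * (ω x) ^ 2 with hden
  set c := -num / den with hc
  set q : ℕ → ℝ := fun k => p k - 1 with hqdef
  set m : ℕ → ℝ := fun k => supN (u k) with hmdef
  set v : ℕ → E N → ℝ := fun k x => u k x / m k with hvdef
  have hq : ∀ k, 0 < q k := fun k => sub_pos.2 (hp k)
  have hq0 : Tendsto q atTop (𝓝 0) := by simpa using hp1.sub_const 1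
  have hm : ∀ k, 0 < m k := fun k => supN_pos (hsol k).2.1 (hnt k)
  have hωc := hω.2.1
  have hden_pos : 0 < den := integral_weight_mul_sq_pos hN hα hωc hω.2.2.1 hω.2.2.2.2
  have hvc : ∀ k, ContinuousOn (v k) (closedBall 0 1) := fun k => (hsol k).2.1.div_const _
  have hv1 : ∀ k, ∀ x ∈ closedBall (0 : E N) 1, |v k x| ≤ 1 := fun k x hx => by
    simp only [hvdef]
    rw [abs_div, abs_of_pos (hm k), div_le_one (hm k)]
    exact abs_le_supN (hsol k).2.1 hx
  have hωle : ∀ x ∈ closedBall (0 : E N) 1, |ω x| ≤ 1 := fun x hx =>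
    hω1 ▸ abs_le_supN hωc hx
  have hvlim : ∀ x ∈ closedBall (0 : E N) 1, Tendsto (fun k => v k x) atTop (𝓝 (ω x)) :=
    fun x hx => hconv2.tendsto_at hx
  have hW : ContinuousOn (fun x : E N => ‖x‖ ^ α) (closedBall 0 1) :=
    (continuous_norm_rpow hα).continuousOn
  have hvq : ∀ k, ContinuousOn (fun x => |v k x| ^ q k) (closedBall 0 1) := fun k =>
    (hvc k).abs.rpow_const fun _ _ => Or.inr (hq k).le
  have hfin : IntegrableOn (fun _ : E N => (1 : ℝ)) S :=
    integrableOn_ball_of_continuousOn continuousOn_const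
  have hI : Tendsto (fun k => ∫ x in S, ‖x‖ ^ α * (|v k x| ^ q k * v k x * ω x)) atTop
      (𝓝 den) := by
    refine tendsto_integral_of_dominated_convergence (fun _ => 1) (fun k => ?_) hfin (fun k => ?_)
      ?_
    · exact (integrableOn_ball_of_continuousOn
        (hW.mul (((hvq k).mul (hvc k)).mul hωc))).aestronglyMeasurable
    · refine (ae_restrict_iff' measurableSet_ball).2 (ae_of_all _ fun x hx => ?_)
      have hx' := ball_subset_closedBall hx
      rw [Real.norm_eq_abs, abs_mul, abs_mul, abs_mul, abs_of_nonneg (by positivity : 0 ≤ ‖x‖ ^ α),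
        abs_of_nonneg (by positivity : 0 ≤ |v k x| ^ q k)]
      exact mul_le_one₀ (norm_rpow_le_one hα hx) (by positivity)
        (mul_le_one₀ (mul_le_one₀ (Real.rpow_le_one (abs_nonneg _) (hv1 k x hx') (hq k).le)
          (abs_nonneg _) (hv1 k x hx')) (abs_nonneg _) (hωle x hx'))
    · refine (ae_restrict_iff' measurableSet_ball).2 (ae_of_all _ fun x hx => ?_)
      have hx' := ball_subset_closedBall hx
      rcases eq_or_ne (ω x) 0 with h0 | h0
      · simp [h0]
      · have := ((((hvlim x hx').abs.rpow hq0 (Or.inl (abs_ne_zero.2 h0))).mul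
          (hvlim x hx')).mul_const (ω x)).const_mul (‖x‖ ^ α)
        simpa [sq] using this
  have hJ : Tendsto (fun k => ∫ x in S, ‖x‖ ^ α * ((|v k x| ^ q k - 1) / q k * v k x * ω x)) atTop
      (𝓝 num) := by
    refine tendsto_integral_of_dominated_convergence (fun _ => 1) (fun k => ?_) hfin (fun k => ?_)
      ?_
    · exact (integrableOn_ball_of_continuousOn (hW.mul (((((hvq k).sub
        continuousOn_const).div_const _).mul (hvc k)).mul hωc))).aestronglyMeasurable
    · refine (ae_restrict_iff' measurableSet_ball).2 (ae_of_all _ fun x hx => ?_)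
      have hx' := ball_subset_closedBall hx
      rw [Real.norm_eq_abs, abs_mul, abs_mul, abs_of_nonneg (by positivity : 0 ≤ ‖x‖ ^ α)]
      exact mul_le_one₀ (norm_rpow_le_one hα hx) (by positivity)
        (mul_le_one₀ (abs_rpow_sub_one_div_mul_le_one (hv1 k x hx') (hq k))
          (abs_nonneg _) (hωle x hx'))
    · refine (ae_restrict_iff' measurableSet_ball).2 (ae_of_all _ fun x hx => ?_)
      have hx' := ball_subset_closedBall hx
      rcases eq_or_ne (ω x) 0 with h0 | h0
      · simp [h0]
      · have := (((tendsto_rpow_sub_one_div (abs_pos.2 h0) (hvlim x hx').abs hq hq0).mul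
          (hvlim x hx')).mul_const (ω x)).const_mul (‖x‖ ^ α)
        refine this.trans_eq ?_
        ring_nf
  have hkey : ∀ k, (m k ^ q k - μ) * (∫ x in S, ‖x‖ ^ α * (|v k x| ^ q k * v k x * ω x)) +
      μ * q k * (∫ x in S, ‖x‖ ^ α * ((|v k x| ^ q k - 1) / q k * v k x * ω x)) = 0 := fun k =>
    sub_mul_integral_add_eq_zero hα (hp k) (hsol k) hω (hm k)
  have hratio : Tendsto (fun k => (m k ^ q k - μ) / q k) atTop (𝓝 (μ * c)) := by
    have h1 := (hJ.const_mul (-μ)).div hI hden_pos.ne'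
    rw [show -μ * num / den = μ * c by rw [hc]; ring] at h1
    refine h1.congr' ?_
    filter_upwards [hI.eventually (lt_mem_nhds hden_pos)] with k hk
    have hqk := (hq k).ne'
    simp only [Pi.div_apply]
    rw [div_eq_div_iff hk.ne' hqk]
    linarith [hkey k]
  constructor
  · have := hratio.sub_const (μ * c)
    rw [sub_self] at this
    refine this.congr fun k => ?_
    have hqk := (hq k).ne'
    change _ = (m k ^ q k - μ * (1 + c * q k)) / q k
    field_simp
    ring
  · have hy : Tendsto (fun k => m k ^ q k / μ) atTop (𝓝 1) := by
      simpa [hμ.ne'] using hconv1.div_const μ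
    have hyc : Tendsto (fun k => (m k ^ q k / μ - 1) / q k) atTop (𝓝 c) := by
      have := hratio.div_const μ
      rw [mul_div_cancel_left₀ c hμ.ne'] at this
      refine this.congr fun k => ?_
      field_simp
    have hypos : ∀ k, 0 < m k ^ q k / μ := fun k => div_pos (Real.rpow_pos_of_pos (hm k) _) hμ
    have hlog : Tendsto (fun k => Real.log (m k ^ q k / μ) / q k) atTop (𝓝 c) := by
      have hlow : Tendsto (fun k => (m k ^ q k / μ - 1) / q k / (m k ^ q k / μ)) atTop (𝓝 c) := by
        have := hyc.div hy one_ne_zero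
        rwa [div_one] at this
      refine tendsto_of_tendsto_of_tendsto_of_le_of_le hlow hyc (fun k => ?_) fun k => ?_
      · have h := Real.one_sub_inv_le_log_of_pos (hypos k)
        have hyk := (hypos k).ne'
        simp only
        rw [div_right_comm, sub_div, div_self hyk, one_div]
        exact div_le_div_of_nonneg_right h (hq k).le
      · exact div_le_div_of_nonneg_right (Real.log_le_sub_one_of_pos (hypos k)) (hq k).le
    have hfac : Tendsto (fun k => μ ^ (-(1 / q k)) * m k) atTop (𝓝 (Real.exp c)) := by
      refine ((Real.continuous_exp.tendsto c).comp hlog).congr fun k => ?_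
      have hqk := (hq k).ne'
      rw [Function.comp_apply, Real.log_div (Real.rpow_pos_of_pos (hm k) _).ne' hμ.ne',
        Real.log_rpow (hm k), Real.rpow_def_of_pos hμ]
      conv_rhs => rw [← Real.exp_log (hm k), ← Real.exp_add]
      congr 1
      field_simp
      ring
    rw [Metric.tendstoUniformlyOn_iff] at hconv2 ⊢
    intro ε hε
    have hec := Real.exp_pos c
    have hε2 : 0 < ε / 2 / Real.exp c := by positivity
    filter_upwards [hconv2 _ hε2, Metric.tendsto_nhds.1 hfac _ (half_pos hε)] with k hk hk2 x hx
    have h1 := hk x hx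
    rw [Real.dist_eq] at h1 hk2 ⊢
    have hval : μ ^ (-(1 / (p k - 1))) * u k x = μ ^ (-(1 / q k)) * m k * v k x := by
      simp only [hvdef, hqdef]
      have hmk := (hm k).ne'
      field_simp
    rw [hval]
    have hdec : Real.exp c * ω x - μ ^ (-(1 / q k)) * m k * v k x =
        Real.exp c * (ω x - v k x) - (μ ^ (-(1 / q k)) * m k - Real.exp c) * v k x := by ring
    rw [hdec]
    refine (abs_sub _ _).trans_lt ?_
    rw [abs_mul, abs_mul, abs_of_pos hec]
    have h2 : Real.exp c * |ω x - v k x| < ε / 2 := by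
      rwa [lt_div_iff₀' hec] at h1
    have h3 : |μ ^ (-(1 / q k)) * m k - Real.exp c| * |v k x| < ε / 2 :=
      (mul_le_of_le_one_right (abs_nonneg _) (hv1 k x hx)).trans_lt hk2
    linarith
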